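/- arXiv:1710.04310 — 2 statements merged into one kernel-verified Lean document; each statement's English description precedes it below -/
import Mathlib

section
/- Let F := (z₂ − 2)² − (z₁ − 1)(z₁⁵ + 2z₁ + 5)² ∈ ℂ[z₁,z₂]. There exists a finite subset S ⊂ ℂ² such that for every point P = (p₁, p₂) ∈ (ℂ*)² with F(P) = 0 and P ∉ S, for generic (a₁, a₂) ∈ ℂ², the set {z ∈ (ℂ*)² : F(z) = 0, a₁(z₁ − p₁) + a₂(z₂ − p₂) = 0, and z ≠ P} has exactly 10 elements. (The second removal ML degree of the hyperelliptic curve with respect to a general point on the curve is r₂ = 10, in contrast with the value 9 at each of its five singular points.) -/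
section

open MvPolynomial

/-- The hyperelliptic curve `(y − 2)² = (x − 1)(x⁵ + 2x + 5)²`. -/
noncomputable def hyperF : MvPolynomial (Fin 2) ℂ :=
  (X 1 - 2) ^ 2 - (X 0 - 1) * (X 0 ^ 5 + 2 * X 0 + 5) ^ 2

end

namespace Hyperelliptic

open Polynomial in
/-- The zeros of a nonzero univariate polynomial form a finite set. -/
lemma finite_eval_eq_zero {D : ℂ[X]} (hD : D ≠ 0) : {x : ℂ | D.eval x = 0}.Finite :=
  Polynomial.finite_setOfPred_isRoot hD

open Polynomial in
/-- Only finitely many members of the pencil `2qt + t²(X - p) - r` have a multiple root. -/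
lemma finite_tangent_slopes (r : ℂ[X]) (hr : 2 ≤ r.natDegree) (p q : ℂ) :
    {t : ℂ | ∃ x, 2 * q * t + t ^ 2 * (x - p) = r.eval x ∧
      t ^ 2 = r.derivative.eval x}.Finite := by
  set w : ℂ[X] := r - (X - C p) * derivative r with hw
  set D : ℂ[X] := C (4 * q ^ 2) * derivative r - w ^ 2 with hD
  have hr0 : r ≠ 0 := by
    rintro rfl
    simp at hr
  have hcoeff : w.coeff r.natDegree ≠ 0 := by
    obtain ⟨n, hn⟩ : ∃ n, r.natDegree = n + 1 := ⟨r.natDegree - 1, by omega⟩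
    have htop : r.coeff (n + 1 + 1) = 0 := coeff_eq_zero_of_natDegree_lt (by omega)
    have hlead : r.coeff (n + 1) ≠ 0 := by
      rw [← hn]
      exact leadingCoeff_ne_zero.mpr hr0
    have hn0 : (n : ℂ) ≠ 0 := by
      exact_mod_cast (by omega : n ≠ 0)
    have : w.coeff (n + 1) = -(n * r.coeff (n + 1)) := by
      rw [hw, coeff_sub, sub_mul, coeff_sub, coeff_X_mul, coeff_C_mul, coeff_derivative,
        coeff_derivative, htop]
      ring
    rw [hn, this]
    exact neg_ne_zero.mpr (mul_ne_zero hn0 hlead)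
  have hD0 : D ≠ 0 := by
    intro h
    have h1 : w ^ 2 = C (4 * q ^ 2) * derivative r := (sub_eq_zero.mp h).symm
    have h2 := congrArg natDegree h1
    have h3 : r.natDegree ≤ w.natDegree := le_natDegree_of_ne_zero hcoeff
    have h4 : (C (4 * q ^ 2) * derivative r).natDegree ≤ r.natDegree - 1 :=
      (natDegree_C_mul_le _ _).trans (natDegree_derivative_le r)
    rw [natDegree_pow] at h2
    omega
  refine ((finite_eval_eq_zero hD0).biUnion (t := fun x => {t : ℂ | t ^ 2 = r.derivative.eval x})
    fun x _ => ?_).subset ?_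
  · refine (finite_eval_eq_zero (X_pow_sub_C_ne_zero two_pos (r.derivative.eval x))).subset ?_
    intro t ht
    simpa [sub_eq_zero] using ht
  · rintro t ⟨x, h1, h2⟩
    refine Set.mem_biUnion (x := x) ?_ h2
    simp only [Set.mem_ofPred_eq, hD, hw, eval_sub, eval_mul, eval_pow, eval_C, eval_X]
    rw [← h1, ← h2]
    ring

open Polynomial in
/-- A residual polynomial `2qt + t²(X - p) - r` without multiple roots has `deg r` roots. -/
lemma card_roots_residual (r : ℂ[X]) (hr : 2 ≤ r.natDegree) (p q t : ℂ)
    (ht : ¬ ∃ x, 2 * q * t + t ^ 2 * (x - p) = r.eval x ∧ t ^ 2 = r.derivative.eval x) :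
    {x : ℂ | 2 * q * t + t ^ 2 * (x - p) = r.eval x}.ncard = r.natDegree := by
  set G : ℂ[X] := r - (C (t ^ 2) * X + C (2 * q * t - t ^ 2 * p)) with hG
  have hdeg : G.natDegree = r.natDegree :=
    natDegree_sub_eq_left_of_natDegree_lt (natDegree_linear_le.trans_lt (by omega))
  have hG0 : G ≠ 0 := by
    intro h
    rw [h, natDegree_zero] at hdeg
    omega
  have heval (x : ℂ) : G.eval x = 0 ↔ 2 * q * t + t ^ 2 * (x - p) = r.eval x := by
    simp only [hG, eval_sub, eval_add, eval_mul, eval_C, eval_X]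
    constructor <;> intro h <;> linear_combination -h
  have hnodup : G.roots.Nodup := by
    rw [Multiset.nodup_iff_count_le_one]
    intro x
    by_contra! h
    rw [count_roots, one_lt_rootMultiplicity_iff_isRoot hG0] at h
    refine ht ⟨x, (heval x).mp h.1, ?_⟩
    have h2 := h.2
    simp only [hG, IsRoot.def, derivative_sub, derivative_add, derivative_mul, derivative_C,
      derivative_X, eval_sub, eval_add, eval_mul, eval_C, eval_one, eval_zero] at h2
    linear_combination -h2
  have hset : {x : ℂ | 2 * q * t + t ^ 2 * (x - p) = r.eval x} = (G.roots.toFinset : Set ℂ) := by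
    ext x
    simp [hG0, ← heval]
  rw [hset, Set.ncard_coe_finset, Multiset.toFinset_card_of_nodup hnodup,
    (IsAlgClosed.splits G).natDegree_eq_card_roots.symm, hdeg]

open Polynomial in
/-- The right-hand side of the equation `(y - 2)² = f(x)` of the curve. -/
noncomputable def rhs : ℂ[X] := (X - 1) * (X ^ 5 + 2 * X + 5) ^ 2

lemma natDegree_rhs : rhs.natDegree = 11 := by
  unfold rhs
  compute_degree!

lemma eval_hyperF (z : Fin 2 → ℂ) :
    MvPolynomial.eval z hyperF = (z 1 - 2) ^ 2 - rhs.eval (z 0) := by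
  simp [hyperF, rhs]

open Polynomial in
/-- The divided difference of `rhs` at `p`. -/
lemma exists_divided_difference (p : ℂ) :
    ∃ r : ℂ[X], r.natDegree = 10 ∧
      ∀ x, rhs.eval x - rhs.eval p = (x - p) * r.eval x := by
  refine ⟨rhs /ₘ (X - C p), ?_, fun x => ?_⟩
  · rw [natDegree_divByMonic _ (monic_X_sub_C p), natDegree_rhs, natDegree_X_sub_C]
  · have h := congrArg (eval x) (modByMonic_add_div rhs (X - C p))
    rw [modByMonic_X_sub_C_eq_C_eval] at h
    simp only [eval_add, eval_mul, eval_sub, eval_C, eval_X] at h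
    linear_combination -h

open Polynomial in
/-- All but finitely many slopes give ten further points on the line through `P`. -/
lemma finite_exceptional_slopes (P : Fin 2 → ℂ) (hP : ∀ i, P i ≠ 0)
    (hcurve : (P 1 - 2) ^ 2 = rhs.eval (P 0)) (hq : P 1 ≠ 2) :
    ∃ B : Finset ℂ, ∀ t ∉ B,
      {z : Fin 2 → ℂ | (∀ i, z i ≠ 0) ∧ (z 1 - 2) ^ 2 = rhs.eval (z 0) ∧
        z 1 = P 1 + t * (z 0 - P 0) ∧ z ≠ P}.ncard = 10 := by
  obtain ⟨r, hr, hdiff⟩ := exists_divided_difference (P 0)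
  have hq' : P 1 - 2 ≠ 0 := sub_ne_zero.mpr hq
  have htan := finite_tangent_slopes r (by omega) (P 0) (P 1 - 2)
  have hxaxis : {t : ℂ | 2 * (P 1 - 2) * t + t ^ 2 * (0 - P 0) = r.eval 0}.Finite := by
    have hne : C (-P 0) * X ^ 2 + C (2 * (P 1 - 2)) * X + C (-r.eval 0) ≠ 0 := by
      intro h
      have := congrArg (fun s : ℂ[X] => s.coeff 2) h
      simp [hP 0] at this
    refine (finite_eval_eq_zero hne).subset fun t ht => ?_
    simp only [Set.mem_ofPred_eq, eval_add, eval_mul, eval_C, eval_X, eval_pow] at ht ⊢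
    linear_combination ht
  have hyaxis : {t : ℂ | ∃ x, rhs.eval x = 4 ∧ P 1 + t * (x - P 0) = 0}.Finite := by
    have hne : rhs - C 4 ≠ 0 := by
      intro h
      have := congrArg natDegree h
      rw [natDegree_sub_C, natDegree_rhs] at this
      simp at this
    refine ((finite_eval_eq_zero hne).image fun x => -P 1 / (x - P 0)).subset ?_
    rintro t ⟨x, hx, ht⟩
    refine ⟨x, by simp [hx], ?_⟩
    have hxp : x - P 0 ≠ 0 := by
      intro h
      rw [h] at ht
      exact hP 1 (by simpa using ht)
    rw [div_eq_iff hxp]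
    linear_combination -ht
  refine ⟨(htan.union (hxaxis.union (hyaxis.union
    (Set.finite_singleton (r.eval (P 0) / (2 * (P 1 - 2))))))).toFinset, fun t ht => ?_⟩
  simp only [Set.Finite.mem_toFinset, Set.mem_union, not_or] at ht
  obtain ⟨ht1, ht2, ht3, ht4⟩ := ht
  rw [← hr, ← card_roots_residual r (by omega) (P 0) (P 1 - 2) t ht1]
  have himage : {z : Fin 2 → ℂ | (∀ i, z i ≠ 0) ∧ (z 1 - 2) ^ 2 = rhs.eval (z 0) ∧
        z 1 = P 1 + t * (z 0 - P 0) ∧ z ≠ P} =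
      (fun x : ℂ => ![x, P 1 + t * (x - P 0)]) ''
        {x : ℂ | 2 * (P 1 - 2) * t + t ^ 2 * (x - P 0) = r.eval x} := by
    ext z
    constructor
    · rintro ⟨-, hF, hline, hzP⟩
      have hz : ![z 0, P 1 + t * (z 0 - P 0)] = z := by
        ext i
        fin_cases i <;> simp [hline]
      refine ⟨z 0, ?_, hz⟩
      have h0 : z 0 - P 0 ≠ 0 := by
        intro h
        apply hzP
        rw [← hz, h]
        ext i
        fin_cases i <;> simp [sub_eq_zero.mp h]
      refine mul_left_cancel₀ h0 ?_
      rw [← hdiff, ← hcurve, ← hF, hline]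
      ring
    · rintro ⟨x, hx, rfl⟩
      have hx' : 2 * (P 1 - 2) * t + t ^ 2 * (x - P 0) = r.eval x := hx
      have hF : (P 1 + t * (x - P 0) - 2) ^ 2 = rhs.eval x := by
        linear_combination hcurve + (x - P 0) * hx' - hdiff x
      refine ⟨?_, by simpa using hF, by simp, ?_⟩
      · rw [Fin.forall_fin_two]
        refine ⟨?_, ?_⟩
        · rintro h
          have h0 : x = 0 := by simpa using h
          rw [h0] at hx
          exact ht2 hx
        · intro h
          have h0 : P 1 + t * (x - P 0) = 0 := by simpa using h
          refine ht3 ⟨x, ?_, h0⟩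
          rw [← hF, h0]
          norm_num
      · intro h
        have h0 : x = P 0 := by simpa using congrFun h 0
        rw [h0] at hx'
        refine ht4 ?_
        rw [Set.mem_singleton_iff, eq_div_iff (mul_ne_zero two_ne_zero hq')]
        linear_combination hx'
  rw [himage, Set.ncard_image_of_injective]
  intro x y hxy
  simpa using congrFun hxy 0

/-- The points of the curve on the line `y = 2` are finite in number. -/
lemma finite_curve_inter_line :
    {P : Fin 2 → ℂ | P 1 = 2 ∧ rhs.eval (P 0) = 0}.Finite := by
  have hne : rhs ≠ 0 := by
    intro h
    have := natDegree_rhs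
    simp [h] at this
  refine ((finite_eval_eq_zero hne).image fun x => ![x, 2]).subset ?_
  rintro P ⟨h1, h0⟩
  refine ⟨P 0, h0, ?_⟩
  ext i
  fin_cases i <;> simp [h1]

end Hyperelliptic

open MvPolynomial Hyperelliptic in
/-- **The second removal ML degree of the hyperelliptic curve with respect to a general
point on the curve is `r₂ = 10`.**  There is a finite set `S ⊂ ℂ²` such that for every
torus point `P` of the curve with `P ∉ S`, for generic `(a₁, a₂) ∈ ℂ²`, the general
line `a₁(z₁ − P₁) + a₂(z₂ − P₂) = 0` through `P` meets the curve in exactly `10` torus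
points other than `P` itself. -/
theorem hyperelliptic_removal_ml_degree_two_general :
    ∃ S : Set (Fin 2 → ℂ), S.Finite ∧
      ∀ P : Fin 2 → ℂ, (∀ i, P i ≠ 0) → eval P hyperF = 0 → P ∉ S →
        ∃ g : MvPolynomial (Fin 2) ℂ, g ≠ 0 ∧
          ∀ a : Fin 2 → ℂ, eval a g ≠ 0 →
            {z : Fin 2 → ℂ | (∀ i, z i ≠ 0) ∧ eval z hyperF = 0 ∧
                a 0 * (z 0 - P 0) + a 1 * (z 1 - P 1) = 0 ∧ z ≠ P}.ncard = 10 := by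
  refine ⟨_, finite_curve_inter_line, fun P hP hF hS => ?_⟩
  rw [eval_hyperF, sub_eq_zero] at hF
  have hq : P 1 ≠ 2 := by
    intro h
    refine hS ⟨h, ?_⟩
    rw [← hF, h]
    ring
  obtain ⟨B, hB⟩ := finite_exceptional_slopes P hP hF hq
  refine ⟨X 1 * ∏ t ∈ B, (X 0 + C t * X 1), ?_, fun a ha => ?_⟩
  · refine mul_ne_zero (X_ne_zero 1) (Finset.prod_ne_zero_iff.mpr fun t _ h => ?_)
    simpa using congrArg (eval ![1, 0]) h
  · simp only [map_mul, eval_X, map_prod, map_add, eval_C] at ha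
    obtain ⟨ha1, hprod⟩ := mul_ne_zero_iff.mp ha
    have ht : -a 0 / a 1 ∉ B := by
      intro h
      refine Finset.prod_ne_zero_iff.mp hprod _ h ?_
      field_simp
      ring
    rw [← hB _ ht]
    congr 1
    ext z
    have hline : a 0 * (z 0 - P 0) + a 1 * (z 1 - P 1) = 0 ↔
        z 1 = P 1 + -a 0 / a 1 * (z 0 - P 0) := by
      constructor
      · intro h
        field_simp
        linear_combination h
      · intro h
        rw [h]
        field_simp
        ring
    simp only [Set.mem_ofPred_eq, eval_hyperF, sub_eq_zero (a := (z 1 - 2) ^ 2), hline]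
end

section
/- For every integer D ≥ 1 there exists a nonzero polynomial G in the variables (c_{ij})_{i+j≤D} such that whenever G(c) ≠ 0, writing f_c := Σ_{i+j≤D} c_{ij} z₁^i z₂^j, there exists a finite subset S ⊂ ℂ² such that for every point P = (p₁, p₂) ∈ (ℂ*)² with f_c(P) = 0 and P ∉ S, for generic (a₁, a₂) ∈ ℂ², the set {z ∈ (ℂ*)² : f_c(z) = 0, a₁(z₁ − p₁) + a₂(z₂ − p₂) = 0, and z ≠ P} has exactly D − 1 elements. (The second removal ML degree of a general degree-D very affine plane curve with respect to a general smooth point on it is r₂ = D − 1.) -/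
open MvPolynomial

/-- Index set for the coefficients `c_{ij}` with `i + j ≤ D` of a plane curve of degree `D`. -/
abbrev CoeffIdx (D : ℕ) := {p : Fin (D + 1) × Fin (D + 1) // (p.1 : ℕ) + (p.2 : ℕ) ≤ D}

/-- The plane curve `f_c = Σ_{i+j≤D} c_{ij} z₁^i z₂^j` with coefficients `c`. -/
noncomputable def planeCurve (D : ℕ) (c : CoeffIdx D → ℂ) : MvPolynomial (Fin 2) ℂ :=
  ∑ p : CoeffIdx D, C (c p) * X 0 ^ (p.1.1 : ℕ) * X 1 ^ (p.1.2 : ℕ)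

/-- The restriction of the plane curve with coefficients `k` to the parametrised line
`t ↦ (x₀ + v₀ t, x₁ + v₁ t)`. -/
noncomputable def linePoly {R : Type*} [CommRing R] (D : ℕ) (k : CoeffIdx D → R)
    (x₀ v₀ x₁ v₁ : R) : Polynomial R :=
  ∑ p : CoeffIdx D, Polynomial.C (k p) *
    (Polynomial.C v₀ * Polynomial.X + Polynomial.C x₀) ^ (p.1.1 : ℕ) *
    (Polynomial.C v₁ * Polynomial.X + Polynomial.C x₁) ^ (p.1.2 : ℕ)

lemma linePoly_map {R S : Type*} [CommRing R] [CommRing S] (φ : R →+* S) (D : ℕ)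
    (k : CoeffIdx D → R) (x₀ v₀ x₁ v₁ : R) :
    (linePoly D k x₀ v₀ x₁ v₁).map φ =
      linePoly D (fun p => φ (k p)) (φ x₀) (φ v₀) (φ x₁) (φ v₁) := by
  simp [linePoly, Polynomial.map_sum]

lemma linePoly_natDegree_le {R : Type*} [CommRing R] (D : ℕ)
    (k : CoeffIdx D → R) (x₀ v₀ x₁ v₁ : R) : (linePoly D k x₀ v₀ x₁ v₁).natDegree ≤ D := by
  refine Polynomial.natDegree_sum_le_of_forall_le _ _ fun p _ => ?_
  have h (v x : R) (n : ℕ) :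
      ((Polynomial.C v * Polynomial.X + Polynomial.C x) ^ n).natDegree ≤ n := by
    simpa using Polynomial.natDegree_pow_le_of_le n
      (Polynomial.natDegree_linear_le (a := v) (b := x))
  refine Polynomial.natDegree_mul_le.trans ((Nat.add_le_add ?_ (h _ _ _)).trans p.2)
  exact (Polynomial.natDegree_C_mul_le _ _).trans (h _ _ _)

lemma linePoly_eval (D : ℕ) (c : CoeffIdx D → ℂ) (x₀ v₀ x₁ v₁ t : ℂ) :
    (linePoly D c x₀ v₀ x₁ v₁).eval t =
      eval ![v₀ * t + x₀, v₁ * t + x₁] (planeCurve D c) := by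
  simp [linePoly, planeCurve, Polynomial.eval_finsetSum]

lemma linePoly_vertical_coeff (D : ℕ) (c : CoeffIdx D → ℂ) (x : ℂ) :
    (linePoly D c x 0 0 1).coeff D = c ⟨(0, Fin.last D), by simp⟩ := by
  simp only [linePoly, Polynomial.finsetSum_coeff]
  rw [Finset.sum_eq_single ⟨(0, Fin.last D), by simp⟩]
  · simp
  · rintro ⟨⟨i, j⟩, h⟩ - hne
    have hj : (j : ℕ) ≠ D := by
      intro hj
      apply hne
      simp only at h
      simp only [Subtype.mk.injEq, Prod.mk.injEq, Fin.ext_iff, Fin.val_last, Fin.val_zero]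
      omega
    simp only [Polynomial.C_0, zero_mul, zero_add, Polynomial.C_1, one_mul, add_zero,
      ← Polynomial.C_pow, ← Polynomial.C_mul, Polynomial.coeff_C_mul, Polynomial.coeff_X_pow,
      Ne.symm hj, if_false, mul_zero]
  · simp

/-- Having full degree and being separable is an open condition on the coefficients. -/
lemma exists_separable_witness {R : Type*} [CommRing R] {D : ℕ} (hD : 1 ≤ D)
    (p : Polynomial R) (hp : p.natDegree ≤ D) :
    ∃ r : R, ∀ φ : R →+* ℂ,
      φ r ≠ 0 ↔ (p.map φ).natDegree = D ∧ (p.map φ).Separable := by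
  refine ⟨p.coeff D * p.resultant p.derivative D (D - 1), fun φ => ?_⟩
  have hle : (p.map φ).natDegree ≤ D := Polynomial.natDegree_map_le.trans hp
  rw [map_mul, ← Polynomial.resultant_map_map, ← Polynomial.derivative_map, ← Polynomial.coeff_map,
    mul_ne_zero_iff]
  set q := p.map φ
  have hdeg : q.coeff D ≠ 0 ↔ q.natDegree = D := by
    refine ⟨fun h => le_antisymm hle (Polynomial.le_natDegree_of_ne_zero h), fun h => ?_⟩
    rw [← h, Polynomial.coeff_natDegree, Polynomial.leadingCoeff_ne_zero]
    rintro h0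
    simp [h0] at h
    omega
  rw [hdeg]
  refine and_congr_right fun h => ?_
  have hq : q ≠ 0 := by
    rintro h0
    simp [h0] at h
    omega
  have hd : q.derivative.natDegree = D - 1 := by
    rw [Polynomial.natDegree_derivative, h]
  rw [← hd]
  nth_rewrite 1 [← h]
  rw [Ne, Polynomial.resultant_eq_zero_iff, Polynomial.Separable]
  simp [hq]

lemma eval_eq_linePoly_vertical (D : ℕ) (c : CoeffIdx D → ℂ) (z : Fin 2 → ℂ) :
    eval z (planeCurve D c) = (linePoly D c (z 0) 0 0 1).eval (z 1) := by
  rw [linePoly_eval]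
  congr 2
  ext i; fin_cases i <;> simp

lemma eval_eq_linePoly_horizontal (D : ℕ) (c : CoeffIdx D → ℂ) (z : Fin 2 → ℂ) :
    eval z (planeCurve D c) = (linePoly D c 0 1 (z 1) 0).eval (z 0) := by
  rw [linePoly_eval]
  congr 2
  ext i; fin_cases i <;> simp

lemma planeCurve_eval_zero (D : ℕ) (c : CoeffIdx D → ℂ) :
    eval 0 (planeCurve D c) = c ⟨(0, 0), by simp⟩ := by
  simp only [planeCurve, map_sum]
  rw [Finset.sum_eq_single ⟨(0, 0), by simp⟩]
  · simp
  · rintro ⟨⟨i, j⟩, h⟩ - hne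
    simp only [Ne, Subtype.mk.injEq, Prod.mk.injEq, not_and_or] at hne
    rcases hne with hne | hne <;> simp [hne]
  · simp

lemma finite_curve_inter_vertical {D : ℕ} {c : CoeffIdx D → ℂ} {x : ℂ}
    (h : linePoly D c x 0 0 1 ≠ 0) :
    {z : Fin 2 → ℂ | eval z (planeCurve D c) = 0 ∧ z 0 = x}.Finite := by
  refine ((linePoly D c x 0 0 1).roots.toFinset.finite_toSet.image fun y => ![x, y]).subset ?_
  rintro z ⟨hz, rfl⟩
  refine ⟨z 1, by simpa [h, ← eval_eq_linePoly_vertical] using hz, ?_⟩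
  ext i; fin_cases i <;> simp

lemma finite_curve_inter_horizontal {D : ℕ} {c : CoeffIdx D → ℂ} {y : ℂ}
    (h : linePoly D c 0 1 y 0 ≠ 0) :
    {z : Fin 2 → ℂ | eval z (planeCurve D c) = 0 ∧ z 1 = y}.Finite := by
  refine ((linePoly D c 0 1 y 0).roots.toFinset.finite_toSet.image fun x => ![x, y]).subset ?_
  rintro z ⟨hz, rfl⟩
  refine ⟨z 0, by simpa [h, ← eval_eq_linePoly_horizontal] using hz, ?_⟩
  ext i; fin_cases i <;> simp

/-- A general line through `P` avoids finitely many given points other than `P`. -/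
lemma exists_line_avoiding {T : Set (Fin 2 → ℂ)} (hT : T.Finite) {P : Fin 2 → ℂ} (hP : P ∉ T) :
    ∃ g : MvPolynomial (Fin 2) ℂ, g ≠ 0 ∧ ∀ a : Fin 2 → ℂ, eval a g ≠ 0 →
      ∀ z ∈ T, a 0 * (z 0 - P 0) + a 1 * (z 1 - P 1) ≠ 0 := by
  refine ⟨∏ z ∈ hT.toFinset, (X 0 * C (z 0 - P 0) + X 1 * C (z 1 - P 1)), ?_, ?_⟩
  · rw [Finset.prod_ne_zero_iff]
    intro z hz h0
    rw [Set.Finite.mem_toFinset] at hz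
    have h1 := congrArg (eval ![1, 0]) h0
    have h2 := congrArg (eval ![0, 1]) h0
    simp [sub_eq_zero] at h1 h2
    apply hP
    convert hz
    ext i; fin_cases i <;> simp [h1, h2]
  · intro a ha z hz
    rw [eval_prod, Finset.prod_ne_zero_iff] at ha
    simpa using ha z (by simpa using hz)

lemma separable_comp_X_add_C {K : Type*} [Field K] {q : Polynomial K} (hq : q.Separable) (y : K) :
    (q.comp (Polynomial.X + Polynomial.C y)).Separable := by
  have := IsCoprime.map hq (Polynomial.compRingHom (Polynomial.X + Polynomial.C y))
  simpa [Polynomial.Separable, Polynomial.derivative_comp] using this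

/-- A polynomial of degree `D` with simple roots that vanishes at `0` has `D - 1` nonzero roots. -/
lemma ncard_nonzero_roots {D : ℕ} {q : Polynomial ℂ} (hdeg : q.natDegree = D)
    (hsep : q.Separable) (h0 : q.eval 0 = 0) :
    {t : ℂ | q.eval t = 0 ∧ t ≠ 0}.ncard = D - 1 := by
  have hset : {t : ℂ | q.eval t = 0 ∧ t ≠ 0} = ↑(q.roots.toFinset.erase 0) := by
    ext t
    simp [hsep.ne_zero, and_comm]
  rw [hset, Set.ncard_coe_finset, Finset.card_erase_of_mem (by simpa [hsep.ne_zero] using h0),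
    Multiset.toFinset_card_of_nodup (Polynomial.nodup_roots hsep),
    ← (IsAlgClosed.splits q).natDegree_eq_card_roots, hdeg]

/-- If the restriction of the curve to the line through `P` is separable of degree `D`, and the
line avoids the points of the curve outside the torus, then it meets the curve in `D - 1` torus
points other than `P`. -/
lemma ncard_line_inter {D : ℕ} {c : CoeffIdx D → ℂ} {P a : Fin 2 → ℂ}
    (hP : eval P (planeCurve D c) = 0)
    (hdeg : (linePoly D c (P 0) (a 1) (P 1) (-a 0)).natDegree = D)
    (hsep : (linePoly D c (P 0) (a 1) (P 1) (-a 0)).Separable)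
    (hT : ∀ z : Fin 2 → ℂ, eval z (planeCurve D c) = 0 →
      a 0 * (z 0 - P 0) + a 1 * (z 1 - P 1) = 0 → ∀ i, z i ≠ 0) :
    {z : Fin 2 → ℂ | (∀ i, z i ≠ 0) ∧ eval z (planeCurve D c) = 0 ∧
      a 0 * (z 0 - P 0) + a 1 * (z 1 - P 1) = 0 ∧ z ≠ P}.ncard = D - 1 := by
  have hPeq : ![P 0, P 1] = P := by ext i; fin_cases i <;> simp
  have ha : a 0 ≠ 0 ∨ a 1 ≠ 0 := by
    by_contra! h
    have : linePoly D c (P 0) (a 1) (P 1) (-a 0) = 0 := by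
      ext1 n
      have hC : linePoly D c (P 0) (a 1) (P 1) (-a 0) =
          Polynomial.C ((linePoly D c (P 0) (a 1) (P 1) (-a 0)).eval 0) := by
        simp [linePoly, h.1, h.2, Polynomial.eval_finsetSum]
      rw [hC, linePoly_eval]
      simp [hPeq, hP]
    exact hsep.ne_zero this
  rw [← ncard_nonzero_roots hdeg hsep (by rw [linePoly_eval]; simpa [hPeq] using hP)]
  symm
  have hinj : Function.Injective fun t : ℂ => ![a 1 * t + P 0, -a 0 * t + P 1] := by
    intro s t hst
    have h0 := congrFun hst 0
    have h1 := congrFun hst 1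
    simp at h0 h1
    grind
  rw [← Set.ncard_image_of_injective _ hinj]
  congr 1
  ext z
  simp only [Set.mem_image, Set.mem_ofPred_eq, linePoly_eval]
  constructor
  · rintro ⟨t, ⟨ht, ht0⟩, rfl⟩
    have hl : a 0 * (![a 1 * t + P 0, -a 0 * t + P 1] 0 - P 0) +
        a 1 * (![a 1 * t + P 0, -a 0 * t + P 1] 1 - P 1) = 0 := by
      simp; ring
    refine ⟨hT _ ht hl, ht, hl, fun h => ht0 (hinj ?_)⟩
    simpa [hPeq] using h
  · rintro ⟨-, hz, hl, hne⟩
    obtain ⟨t, h0, h1⟩ : ∃ t, z 0 = a 1 * t + P 0 ∧ z 1 = -a 0 * t + P 1 := by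
      rcases ha with h | h
      · refine ⟨-(z 1 - P 1) / a 0, ?_, ?_⟩ <;> field_simp <;> grind
      · refine ⟨(z 0 - P 0) / a 1, ?_, ?_⟩ <;> field_simp <;> grind
    have hzt : ![a 1 * t + P 0, -a 0 * t + P 1] = z := by
      ext i; fin_cases i <;> simp [h0, h1]
    refine ⟨t, ⟨by rwa [hzt], ?_⟩, hzt⟩
    rintro rfl
    exact hne (by simpa [hPeq] using hzt.symm)

/-- **The second removal ML degree of a general degree-`D` very affine plane curve with
respect to a general smooth point on it is `r₂ = D − 1`.**  There is a nonzero polynomial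
`G` in the coefficients `c_{ij}` such that whenever `G(c) ≠ 0`, there is a finite set
`S ⊂ ℂ²` such that for every torus point `P` of the curve `f_c` with `P ∉ S`, for generic
`(a₁, a₂) ∈ ℂ²`, the line `a₁(z₁ − P₁) + a₂(z₂ − P₂) = 0` through `P` meets the curve in
exactly `D − 1` torus points other than `P` itself. -/
theorem removal_ml_degree_two_general_smooth_point (D : ℕ) (hD : 1 ≤ D) :
    ∃ G : MvPolynomial (CoeffIdx D) ℂ, G ≠ 0 ∧
      ∀ c : CoeffIdx D → ℂ, eval c G ≠ 0 →
        ∃ S : Set (Fin 2 → ℂ), S.Finite ∧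
          ∀ P : Fin 2 → ℂ, (∀ i, P i ≠ 0) → eval P (planeCurve D c) = 0 → P ∉ S →
            ∃ g : MvPolynomial (Fin 2) ℂ, g ≠ 0 ∧
              ∀ a : Fin 2 → ℂ, eval a g ≠ 0 →
                {z : Fin 2 → ℂ | (∀ i, z i ≠ 0) ∧ eval z (planeCurve D c) = 0 ∧
                    a 0 * (z 0 - P 0) + a 1 * (z 1 - P 1) = 0 ∧ z ≠ P}.ncard = D - 1 := by
  let i₀ : CoeffIdx D := ⟨(0, 0), by simp⟩
  let iD : CoeffIdx D := ⟨(0, Fin.last D), by simp⟩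
  obtain ⟨r, hr⟩ := exists_separable_witness hD
    (linePoly D (X : CoeffIdx D → MvPolynomial (CoeffIdx D) ℂ) 0 0 0 1)
    (linePoly_natDegree_le ..)
  have hr' (c : CoeffIdx D → ℂ) : eval c r ≠ 0 ↔
      (linePoly D c 0 0 0 1).natDegree = D ∧ (linePoly D c 0 0 0 1).Separable := by
    simpa [linePoly_map] using hr (eval c)
  refine ⟨r * X i₀, mul_ne_zero ?_ (X_ne_zero _), fun c hc => ?_⟩
  · let c₀ : CoeffIdx D → ℂ := Pi.single iD 1 - Pi.single i₀ 1
    have hl : linePoly D c₀ 0 0 0 1 = Polynomial.X ^ D - Polynomial.C 1 := by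
      simp [linePoly, c₀, sub_mul, Finset.sum_sub_distrib, Pi.single_apply,
        apply_ite Polynomial.C, ite_mul, i₀, iD]
    have : eval c₀ r ≠ 0 := by
      rw [hr', hl]
      exact ⟨Polynomial.natDegree_X_pow_sub_C,
        Polynomial.separable_X_pow_sub_C _ (by exact_mod_cast (by omega : D ≠ 0)) one_ne_zero⟩
    rintro rfl
    simp at this
  rw [map_mul, eval_X, mul_ne_zero_iff, hr'] at hc
  obtain ⟨⟨hdeg, hsep⟩, hc₀⟩ := hc
  have hcD : c iD ≠ 0 := by
    rw [← linePoly_vertical_coeff D c 0]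
    nth_rewrite 2 [← hdeg]
    simpa using hsep.ne_zero
  have hvert (x : ℂ) : linePoly D c x 0 0 1 ≠ 0 := by
    intro h
    apply hcD
    rw [← linePoly_vertical_coeff D c x, h, Polynomial.coeff_zero]
  have hhor : linePoly D c 0 1 0 0 ≠ 0 := by
    intro h
    apply hc₀
    rw [← planeCurve_eval_zero D c, eval_eq_linePoly_horizontal, Pi.zero_apply,
      Pi.zero_apply, h, Polynomial.eval_zero]
  have hTfin : {z : Fin 2 → ℂ | eval z (planeCurve D c) = 0 ∧ (z 0 = 0 ∨ z 1 = 0)}.Finite := by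
    refine ((finite_curve_inter_vertical (hvert 0)).union
      (finite_curve_inter_horizontal hhor)).subset ?_
    rintro z ⟨hz, h | h⟩
    exacts [Or.inl ⟨hz, h⟩, Or.inr ⟨hz, h⟩]
  obtain ⟨s, hs⟩ := exists_separable_witness hD
    (linePoly D (fun p => Polynomial.C (c p)) Polynomial.X 0 0 1) (linePoly_natDegree_le ..)
  have hs' (x : ℂ) : s.eval x ≠ 0 ↔
      (linePoly D c x 0 0 1).natDegree = D ∧ (linePoly D c x 0 0 1).Separable := by
    simpa [linePoly_map] using hs (Polynomial.evalRingHom x)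
  have hs0 : s ≠ 0 := by
    rintro rfl
    exact (hs' 0).2 ⟨hdeg, hsep⟩ (by simp)
  refine ⟨⋃ x ∈ s.roots.toFinset, {z | eval z (planeCurve D c) = 0 ∧ z 0 = x},
    s.roots.toFinset.finite_toSet.biUnion fun x _ => finite_curve_inter_vertical (hvert x),
    fun P hP hPf hPS => ?_⟩
  have hPs : s.eval (P 0) ≠ 0 := by
    simpa [hs0, hPf] using hPS
  obtain ⟨hPdeg, hPsep⟩ := (hs' _).1 hPs
  obtain ⟨g₁, hg₁, havoid⟩ := exists_line_avoiding hTfin (P := P) (by simp [hP])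
  obtain ⟨g₂, hg₂⟩ := exists_separable_witness hD
    (linePoly D (fun p => (C (c p) : MvPolynomial (Fin 2) ℂ)) (C (P 0)) (X 1) (C (P 1)) (-X 0))
    (linePoly_natDegree_le ..)
  have hg₂' (a : Fin 2 → ℂ) : eval a g₂ ≠ 0 ↔
      (linePoly D c (P 0) (a 1) (P 1) (-a 0)).natDegree = D ∧
        (linePoly D c (P 0) (a 1) (P 1) (-a 0)).Separable := by
    simpa [linePoly_map] using hg₂ (eval a)
  refine ⟨g₁ * g₂, mul_ne_zero hg₁ ?_, fun a ha => ?_⟩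
  · have hcomp : linePoly D c (P 0) 0 (P 1) 1 =
        (linePoly D c (P 0) 0 0 1).comp (Polynomial.X + Polynomial.C (P 1)) := by
      simp [linePoly]
    have : eval ![-1, 0] g₂ ≠ 0 := by
      rw [hg₂']
      simp only [Matrix.cons_val_zero, Matrix.cons_val_one, neg_neg, hcomp]
      refine ⟨?_, separable_comp_X_add_C hPsep _⟩
      rw [Polynomial.natDegree_comp, Polynomial.natDegree_X_add_C, mul_one, hPdeg]
    rintro rfl
    simp at this
  · rw [map_mul, mul_ne_zero_iff, hg₂'] at ha
    obtain ⟨ha₁, hadeg, hasep⟩ := ha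
    refine ncard_line_inter hPf hadeg hasep fun z hz hl => ?_
    by_contra! h
    obtain ⟨i, hi⟩ := h
    refine havoid a ha₁ z ⟨hz, ?_⟩ hl
    fin_cases i
    exacts [Or.inl hi, Or.inr hi]
end
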